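/- Let ρ > 0 and c > 0 with cρ > 1. Then the double series ∑_{m≥1} (ρ^{1−m}/m!) ∑_{n≥m−1} (n+1)^m e^{−c(n+1)} converges (each inner series converges and the outer series of the resulting values converges). -/

import Mathlib

open Real

/-- A power times a decaying exponential is dominated by a slower decaying exponential. -/
theorem pow_mul_exp_neg_mul_le {θ c x : ℝ} (hθ : 0 < θ) (hx : 0 ≤ x) (m : ℕ) :
    x ^ m * Real.exp (-c * x) ≤
      (Nat.factorial m : ℝ) / θ ^ m * Real.exp (-(c - θ) * x) := by
  have h := Real.pow_div_factorial_le_exp (θ * x) (by positivity) m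
  rw [div_le_iff₀ (by positivity), mul_pow] at h
  have hsplit : Real.exp (-(c - θ) * x) = Real.exp (θ * x) * Real.exp (-c * x) := by
    rw [← Real.exp_add]; ring_nf
  rw [hsplit, ← mul_assoc]
  refine mul_le_mul_of_nonneg_right ?_ (Real.exp_pos _).le
  rw [div_mul_eq_mul_div, le_div_iff₀ (by positivity)]
  linarith

/-- Geometric bound for the terms of the inner series. -/
theorem shifted_pow_mul_exp_le {θ c : ℝ} (hθ : 0 < θ) (hθc : θ < c) (k j : ℕ) :
    ((k + j + 1 : ℕ) : ℝ) ^ (k + 1) * Real.exp (-c * ((k + j + 1 : ℕ) : ℝ)) ≤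
      (Nat.factorial (k + 1) : ℝ) / θ ^ (k + 1) * Real.exp (-(c - θ)) ^ j := by
  refine (pow_mul_exp_neg_mul_le hθ (Nat.cast_nonneg _) (k + 1)).trans ?_
  rw [← Real.exp_nat_mul]
  refine mul_le_mul_of_nonneg_left (Real.exp_le_exp.mpr ?_) (by positivity)
  have hj : (j : ℝ) ≤ ((k + j + 1 : ℕ) : ℝ) := by exact_mod_cast (by omega : j ≤ k + j + 1)
  nlinarith

/-- Summability of the double series
`∑_{m≥1} (ρ^{1-m}/m!) ∑_{n≥m-1} (n+1)^m e^{-c(n+1)}` when `cρ > 1`. -/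
theorem double_series_cluster_derivatives_summable
    (ρ c : ℝ) (hρ : 0 < ρ) (hc : 0 < c) (hcρ : 1 < c * ρ) :
    (∀ k : ℕ, Summable (fun j : ℕ =>
      ((k + j + 1 : ℕ) : ℝ) ^ (k + 1) * Real.exp (-c * ((k + j + 1 : ℕ) : ℝ)))) ∧
    Summable (fun k : ℕ =>
      ρ ^ (1 - ((k : ℤ) + 1)) / (Nat.factorial (k + 1) : ℝ) *
        ∑' j : ℕ, ((k + j + 1 : ℕ) : ℝ) ^ (k + 1) * Real.exp (-c * ((k + j + 1 : ℕ) : ℝ))) := by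
  obtain ⟨θ, hρθ, hθc⟩ := exists_between ((div_lt_iff₀ hρ).mpr hcρ)
  have hθ : 0 < θ := (one_div_pos.mpr hρ).trans hρθ
  have hθρ : 1 < θ * ρ := (div_lt_iff₀ hρ).mp hρθ
  have hgeom : Summable (fun j : ℕ => Real.exp (-(c - θ)) ^ j) :=
    summable_geometric_of_lt_one (Real.exp_pos _).le (Real.exp_lt_one_iff.mpr (by linarith))
  have hinner : ∀ k : ℕ, Summable (fun j : ℕ =>
      ((k + j + 1 : ℕ) : ℝ) ^ (k + 1) * Real.exp (-c * ((k + j + 1 : ℕ) : ℝ))) := fun k =>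
    (hgeom.mul_left _).of_nonneg_of_le (fun j => by positivity)
      (shifted_pow_mul_exp_le hθ hθc k)
  refine ⟨hinner, ?_⟩
  have houter : Summable (fun k : ℕ =>
      ((θ * ρ)⁻¹ ^ k) * (θ⁻¹ * ∑' j : ℕ, Real.exp (-(c - θ)) ^ j)) :=
    (summable_geometric_of_lt_one (by positivity) (inv_lt_one_of_one_lt₀ hθρ)).mul_right _
  refine houter.of_nonneg_of_le
    (fun k => mul_nonneg (by positivity) (tsum_nonneg fun j => by positivity)) fun k => ?_
  have htsum := (hinner k).tsum_le_tsum (shifted_pow_mul_exp_le hθ hθc k) (hgeom.mul_left _)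
  rw [tsum_mul_left] at htsum
  refine (mul_le_mul_of_nonneg_left htsum (by positivity)).trans_eq ?_
  have hpow : ρ ^ (1 - ((k : ℤ) + 1)) = (ρ ^ k)⁻¹ := by
    rw [show 1 - ((k : ℤ) + 1) = -(k : ℤ) by ring, zpow_neg, zpow_natCast]
  have hfact : (Nat.factorial (k + 1) : ℝ) ≠ 0 := by positivity
  rw [hpow, inv_pow, mul_pow, pow_succ]
  field_simp
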